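/- For a nonzero multigraded tangent vector φ ∈ [Hom_S(J_A, S/J_A)]_{(0,0)} of fine multidegree e_j − e_i (a linear tangent), one has i < j, and φ is uniquely determined up to scalar: φ(x_i y_h) = x_j y_h when (i,h) ∈ O(A) and (j,h) ∉ O(A), and φ vanishes on all other monomial generators. In particular each such multigraded component of the tangent space has dimension at most 1. -/

import Mathlib

open MvPolynomial

/-- The monomial ideal generated by `x_a y_b` for `(a,b)` in a set `O ⊆ [m] × [n]`. -/
noncomputable def jA (k : Type*) [Field k] (m n : ℕ) (O : Set (Fin m × Fin n)) :
    Ideal (MvPolynomial (Fin m ⊕ Fin n) k) :=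
  Ideal.span {p | ∃ v ∈ O, p = X (Sum.inl v.1) * X (Sum.inr v.2)}

/-- An `S`-linear map `φ : J → S/J` is fine-multigraded of multidegree `d ∈ ℤ^m ⊕ ℤ^n`
if it sends (the class of) each monomial `x^u ∈ J` to a scalar multiple of the monomial
`x^{u+d}` (or to `0`). -/
def FineHomog {k : Type*} [Field k] {m n : ℕ} (O : Set (Fin m × Fin n))
    (d : (Fin m ⊕ Fin n) →₀ ℤ)
    (φ : ↥(jA k m n O) →ₗ[MvPolynomial (Fin m ⊕ Fin n) k]
      (MvPolynomial (Fin m ⊕ Fin n) k ⧸ jA k m n O)) : Prop :=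
  ∀ (u : (Fin m ⊕ Fin n) →₀ ℕ) (h : monomial u (1 : k) ∈ jA k m n O),
    φ ⟨monomial u 1, h⟩ = 0 ∨
    ∃ (c : k) (v : (Fin m ⊕ Fin n) →₀ ℕ), c ≠ 0 ∧
      (∀ t, (v t : ℤ) = (u t : ℤ) + d t) ∧
      φ ⟨monomial u 1, h⟩ = c • Ideal.Quotient.mk (jA k m n O) (monomial v 1)


theorem jA_monomial_mem {k : Type*} [Field k] {m n : ℕ} (O : Set (Fin m × Fin n))
    (u : (Fin m ⊕ Fin n) →₀ ℕ) (h : monomial u (1 : k) ∈ jA k m n O) :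
    ∃ v ∈ O, u (Sum.inl v.1) ≠ 0 ∧ u (Sum.inr v.2) ≠ 0 := by
  have e : ({p | ∃ v ∈ O, p = X (Sum.inl v.1) * X (Sum.inr v.2)} :
      Set (MvPolynomial (Fin m ⊕ Fin n) k)) =
      (fun s => monomial s (1 : k)) '' ((fun v : Fin m × Fin n =>
        (Finsupp.single (Sum.inl v.1) 1 + Finsupp.single (Sum.inr v.2) 1 :
          (Fin m ⊕ Fin n) →₀ ℕ)) '' O) := by
    ext p
    simp only [Set.mem_ofPred_eq, Set.mem_image, exists_exists_and_eq_and]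
    refine exists_congr fun v => and_congr_right fun _ => ?_
    rw [eq_comm, X, X, monomial_mul, one_mul]
  rw [jA, e, mem_ideal_span_monomial_image] at h
  obtain ⟨s, ⟨v, hv, rfl⟩, hs⟩ := h u (by simp [mem_support_iff])
  refine ⟨v, hv, ?_, ?_⟩
  · have := hs (Sum.inl v.1)
    simp at this
    omega
  · have := hs (Sum.inr v.2)
    simp at this
    omega

theorem jA_gen {k : Type*} [Field k] {m n : ℕ} (a : Fin m) (b : Fin n) :
    (X (Sum.inl a) * X (Sum.inr b) : MvPolynomial (Fin m ⊕ Fin n) k) =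
      monomial (Finsupp.single (Sum.inl a) 1 + Finsupp.single (Sum.inr b) 1) 1 := by
  rw [X, X, monomial_mul, one_mul]

theorem fine_other {k : Type*} [Field k] {m n : ℕ} (O : Set (Fin m × Fin n))
    (i j : Fin m) (hij : i ≠ j)
    (φ : ↥(jA k m n O) →ₗ[MvPolynomial (Fin m ⊕ Fin n) k]
      (MvPolynomial (Fin m ⊕ Fin n) k ⧸ jA k m n O))
    (hhom : FineHomog O (Finsupp.single (Sum.inl j) 1 - Finsupp.single (Sum.inl i) 1) φ)
    (a : Fin m) (b : Fin n) (ha : a ≠ i)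
    (hm : X (Sum.inl a) * X (Sum.inr b) ∈ jA k m n O) :
    φ ⟨X (Sum.inl a) * X (Sum.inr b), hm⟩ = 0 := by
  have hm' := hm
  rw [jA_gen] at hm'
  have e : (⟨X (Sum.inl a) * X (Sum.inr b), hm⟩ : jA k m n O) = ⟨_, hm'⟩ :=
    Subtype.ext (jA_gen a b)
  rw [e]
  rcases hhom _ hm' with h | ⟨c, v, -, hv, -⟩
  · exact h
  · exfalso
    have := hv (Sum.inl i)
    simp [ha, hij.symm] at this

theorem fine_same {k : Type*} [Field k] {m n : ℕ} (O : Set (Fin m × Fin n))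
    (i j : Fin m) (hij : i ≠ j)
    (φ : ↥(jA k m n O) →ₗ[MvPolynomial (Fin m ⊕ Fin n) k]
      (MvPolynomial (Fin m ⊕ Fin n) k ⧸ jA k m n O))
    (hhom : FineHomog O (Finsupp.single (Sum.inl j) 1 - Finsupp.single (Sum.inl i) 1) φ)
    (b : Fin n) (hm : X (Sum.inl i) * X (Sum.inr b) ∈ jA k m n O) :
    ∃ c : k, φ ⟨X (Sum.inl i) * X (Sum.inr b), hm⟩ =
      c • Ideal.Quotient.mk (jA k m n O) (X (Sum.inl j) * X (Sum.inr b)) := by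
  have hm' := hm
  rw [jA_gen] at hm'
  have e : (⟨X (Sum.inl i) * X (Sum.inr b), hm⟩ : jA k m n O) = ⟨_, hm'⟩ :=
    Subtype.ext (jA_gen i b)
  rw [e]
  rcases hhom _ hm' with h | ⟨c, v, -, hv, h⟩
  · exact ⟨0, by rw [h, zero_smul]⟩
  · refine ⟨c, ?_⟩
    rw [h, jA_gen]
    congr 3
    congr 1
    ext t
    have := hv t
    simp only [Finsupp.add_apply, Finsupp.sub_apply, Finsupp.single_apply] at this ⊢
    push_cast at this
    zify
    rw [this]
    ring

theorem fine_coeff {k : Type*} [Field k] {m n : ℕ} (O : Set (Fin m × Fin n))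
    (i j : Fin m)
    (φ : ↥(jA k m n O) →ₗ[MvPolynomial (Fin m ⊕ Fin n) k]
      (MvPolynomial (Fin m ⊕ Fin n) k ⧸ jA k m n O))
    (b b' : Fin n) (hm : X (Sum.inl i) * X (Sum.inr b) ∈ jA k m n O)
    (hm' : X (Sum.inl i) * X (Sum.inr b') ∈ jA k m n O) (c c' : k)
    (hc : φ ⟨X (Sum.inl i) * X (Sum.inr b), hm⟩ =
      c • Ideal.Quotient.mk (jA k m n O) (X (Sum.inl j) * X (Sum.inr b)))
    (hc' : φ ⟨X (Sum.inl i) * X (Sum.inr b'), hm'⟩ =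
      c' • Ideal.Quotient.mk (jA k m n O) (X (Sum.inl j) * X (Sum.inr b')))
    (hb : (j, b) ∉ O) (hb' : (j, b') ∉ O) : c = c' := by
  have e : (X (Sum.inr b') : MvPolynomial (Fin m ⊕ Fin n) k) •
      (⟨X (Sum.inl i) * X (Sum.inr b), hm⟩ : jA k m n O) =
      (X (Sum.inr b) : MvPolynomial (Fin m ⊕ Fin n) k) •
      (⟨X (Sum.inl i) * X (Sum.inr b'), hm'⟩ : jA k m n O) := by
    apply Subtype.ext
    simp only [SetLike.val_smul, smul_eq_mul]
    ring
  have e2 := congrArg φ e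
  rw [map_smul, map_smul, hc, hc'] at e2
  by_contra hne
  have e3 : Ideal.Quotient.mk (jA k m n O)
      (C (c - c') * (X (Sum.inl j) * X (Sum.inr b) * X (Sum.inr b'))) = 0 := by
    have h1 : ∀ (d : k) (p q : MvPolynomial (Fin m ⊕ Fin n) k),
        p • (d • Ideal.Quotient.mk (jA k m n O) q) =
          Ideal.Quotient.mk (jA k m n O) (p * (C d * q)) := by
      intro d p q
      rw [← smul_eq_C_mul]
      rfl
    rw [h1, h1, ← sub_eq_zero, ← map_sub] at e2
    rw [← e2]
    congr 1
    rw [C_sub]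
    ring
  rw [Ideal.Quotient.eq_zero_iff_mem] at e3
  have e4 := (jA k m n O).mul_mem_left (C (c - c')⁻¹) e3
  rw [← mul_assoc, ← C_mul, inv_mul_cancel₀ (sub_ne_zero.2 hne), C_1, one_mul, jA_gen, X,
    monomial_mul, one_mul] at e4
  obtain ⟨⟨p, q⟩, hv, h1, h2⟩ := jA_monomial_mem O _ e4
  simp [Finsupp.single_apply] at h1 h2
  subst h1
  by_cases hq : b = q
  · subst hq; exact hb hv
  · by_cases hq' : b' = q
    · subst hq'; exact hb' hv
    · simp [hq, hq'] at h2

theorem fine_zero {k : Type*} [Field k] {m n : ℕ} (O : Set (Fin m × Fin n))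
    (φ : ↥(jA k m n O) →ₗ[MvPolynomial (Fin m ⊕ Fin n) k]
      (MvPolynomial (Fin m ⊕ Fin n) k ⧸ jA k m n O))
    (h : ∀ (a : Fin m) (b : Fin n) (hab : (a, b) ∈ O),
      φ ⟨X (Sum.inl a) * X (Sum.inr b), Ideal.subset_span ⟨(a, b), hab, rfl⟩⟩ = 0) :
    φ = 0 := by
  ext ⟨p, hp⟩
  change φ ⟨p, hp⟩ = 0
  unfold jA at hp
  induction hp using Submodule.span_induction with
  | mem x hx =>
    obtain ⟨⟨a, b⟩, hab, rfl⟩ := hx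
    exact h a b hab
  | zero => exact map_zero φ
  | add x y hx hy h1 h2 =>
    have := map_add φ ⟨x, hx⟩ ⟨y, hy⟩
    rw [h1, h2, add_zero] at this
    exact this
  | smul a x hx h1 =>
    have := map_smul φ a ⟨x, hx⟩
    rw [h1, smul_zero] at this
    exact this

theorem fine_main {k : Type*} [Field k] {m n : ℕ} (O : Set (Fin m × Fin n))
    (hlow : ∀ v v' : Fin m × Fin n, v ≤ v' → v' ∈ O → v ∈ O)
    (i j : Fin m) (hij : i ≠ j)
    (φ : ↥(jA k m n O) →ₗ[MvPolynomial (Fin m ⊕ Fin n) k]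
      (MvPolynomial (Fin m ⊕ Fin n) k ⧸ jA k m n O))
    (hhom : FineHomog O (Finsupp.single (Sum.inl j) 1 - Finsupp.single (Sum.inl i) 1) φ)
    (hne : φ ≠ 0) :
    i < j ∧ ∃ c : k, ∀ (i' : Fin m) (h' : Fin n) (hmem : (i', h') ∈ O),
      φ ⟨X (Sum.inl i') * X (Sum.inr h'),
          Ideal.subset_span ⟨(i', h'), hmem, rfl⟩⟩ =
        (if i' = i then
          c • Ideal.Quotient.mk (jA k m n O) (X (Sum.inl j) * X (Sum.inr h'))
        else 0) := by
  have hz : ∀ h', (j, h') ∈ O →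
      Ideal.Quotient.mk (jA k m n O) (X (Sum.inl j) * X (Sum.inr h')) = 0 := fun h' hj =>
    Ideal.Quotient.eq_zero_iff_mem.2 (Ideal.subset_span ⟨(j, h'), hj, rfl⟩)
  constructor
  · by_contra hlt
    apply hne
    apply fine_zero
    intro a b hab
    by_cases ha : a = i
    · subst ha
      obtain ⟨c, hc⟩ := fine_same O a j hij φ hhom b (Ideal.subset_span ⟨(a, b), hab, rfl⟩)
      rw [hc, hz b (hlow _ (a, b) ⟨not_lt.1 hlt, le_rfl⟩ hab), smul_zero]
    · exact fine_other O i j hij φ hhom a b ha _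
  · by_cases hex : ∃ h0, (i, h0) ∈ O ∧ (j, h0) ∉ O
    · obtain ⟨h0, hi0, hj0⟩ := hex
      obtain ⟨c, hc⟩ := fine_same O i j hij φ hhom h0 (Ideal.subset_span ⟨(i, h0), hi0, rfl⟩)
      refine ⟨c, fun i' h' hmem => ?_⟩
      split_ifs with hi
      · subst hi
        obtain ⟨c', hc'⟩ :=
          fine_same O i' j hij φ hhom h' (Ideal.subset_span ⟨(i', h'), hmem, rfl⟩)
        by_cases hj : (j, h') ∈ O
        · rw [hc', hz h' hj, smul_zero, smul_zero]
        · rw [hc', fine_coeff O i' j φ h0 h' _ _ c c' hc hc' hj0 hj]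
      · exact fine_other O i j hij φ hhom i' h' hi _
    · refine ⟨0, fun i' h' hmem => ?_⟩
      split_ifs with hi
      · subst hi
        obtain ⟨c', hc'⟩ :=
          fine_same O i' j hij φ hhom h' (Ideal.subset_span ⟨(i', h'), hmem, rfl⟩)
        have hj : (j, h') ∈ O := by
          by_contra hj
          exact hex ⟨h', hmem, hj⟩
        rw [hc', hz h' hj, smul_zero, smul_zero]
      · exact fine_other O i j hij φ hhom i' h' hi _

/-- Description of linear tangents: a nonzero fine-multigraded tangent vector
`φ ∈ [Hom_S(J_A, S/J_A)]_{(0,0)}` of multidegree `e_j − e_i` satisfies `i < j` and is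
uniquely determined up to scalar: `φ(x_i y_h) = c · x_j y_h` on generators with first index
`i`, and `φ` vanishes on all other generators.  In particular this multigraded component of
the tangent space is at most one-dimensional. -/
theorem stmt10 {k : Type*} [Field k] {m n : ℕ}
    (A : Set (Fin m × Fin n)) (hA : IsAntichain (· ≤ ·) A)
    (i j : Fin m) (hij : i ≠ j)
    (φ : ↥(jA k m n {v | ∃ w ∈ A, v ≤ w}) →ₗ[MvPolynomial (Fin m ⊕ Fin n) k]
      (MvPolynomial (Fin m ⊕ Fin n) k ⧸ jA k m n {v | ∃ w ∈ A, v ≤ w}))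
    (hhom : FineHomog {v | ∃ w ∈ A, v ≤ w}
      (Finsupp.single (Sum.inl j) 1 - Finsupp.single (Sum.inl i) 1) φ)
    (hne : φ ≠ 0) :
    i < j ∧ ∃ c : k, ∀ (i' : Fin m) (h' : Fin n) (hmem : (i', h') ∈
        ({v | ∃ w ∈ A, v ≤ w} : Set (Fin m × Fin n))),
      φ ⟨X (Sum.inl i') * X (Sum.inr h'),
          Ideal.subset_span ⟨(i', h'), hmem, rfl⟩⟩ =
        (if i' = i then
          c • Ideal.Quotient.mk (jA k m n {v | ∃ w ∈ A, v ≤ w})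
            (X (Sum.inl j) * X (Sum.inr h'))
        else 0) := by
  exact fine_main {v | ∃ w ∈ A, v ≤ w} (by
    rintro v v' h ⟨w, hw, h'⟩
    exact ⟨w, hw, h.trans h'⟩) i j hij φ hhom hne
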